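/- arXiv:2210.08488 — 3 statements merged into one kernel-verified Lean document; each statement's English description precedes it below -/
import Mathlib

section
/- Let S be an N×N matrix over ℂ with diagonalization S = V · diag(λ) · V⁻¹, where V is invertible and the entries of λ ∈ ℂ^N are pairwise distinct. Let X be an N×M complex matrix such that every row of V⁻¹·X has at least one nonzero entry. If an N×N complex matrix H satisfies both S·H = H·S and H·X = 0, then H = 0. -/
/-- Injectivity step of Proposition 1: if `S = V diag(λ) V⁻¹` with pairwise-distinct
eigenvalues, every row of `V⁻¹ X` has a nonzero entry, `S H = H S` and `H X = 0`,
then `H = 0`. -/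
theorem statement7 {N M : ℕ} (S V : Matrix (Fin N) (Fin N) ℂ) (hV : IsUnit V)
    (lam : Fin N → ℂ) (hlam : Function.Injective lam)
    (hS : S = V * Matrix.diagonal lam * V⁻¹)
    (X : Matrix (Fin N) (Fin M) ℂ) (hX : ∀ i : Fin N, ∃ m : Fin M, (V⁻¹ * X) i m ≠ 0)
    (H : Matrix (Fin N) (Fin N) ℂ) (hcomm : S * H = H * S) (hzero : H * X = 0) :
    H = 0 := by
  have hd : IsUnit V.det := (Matrix.isUnit_iff_isUnit_det V).1 hV
  have h1 : V⁻¹ * V = 1 := Matrix.nonsing_inv_mul V hd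
  have h2 : V * V⁻¹ = 1 := Matrix.mul_nonsing_inv V hd
  obtain ⟨K, hK⟩ : ∃ K, K = V⁻¹ * H * V := ⟨_, rfl⟩
  have hH : H = V * K * V⁻¹ := by
    calc H = (V * V⁻¹) * H * (V * V⁻¹) := by rw [h2, one_mul, mul_one]
      _ = V * K * V⁻¹ := by rw [hK]; simp only [mul_assoc]
  have hDK : Matrix.diagonal lam * K = K * Matrix.diagonal lam := by
    calc Matrix.diagonal lam * K
        = (V⁻¹ * V) * Matrix.diagonal lam * K := by rw [h1, one_mul]
      _ = V⁻¹ * (S * H) * V := by rw [hS, hK]; simp only [mul_assoc]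
      _ = V⁻¹ * (H * S) * V := by rw [hcomm]
      _ = K * Matrix.diagonal lam * (V⁻¹ * V) := by rw [hS, hK]; simp only [mul_assoc]
      _ = K * Matrix.diagonal lam := by rw [h1, mul_one]
  have hKX : K * (V⁻¹ * X) = 0 := by
    calc K * (V⁻¹ * X) = V⁻¹ * (H * ((V * V⁻¹) * X)) := by
          rw [hK]; simp only [Matrix.mul_assoc]
      _ = 0 := by rw [h2, Matrix.one_mul, hzero, Matrix.mul_zero]
  have hoff : ∀ i j, i ≠ j → K i j = 0 := by
    intro i j hij
    have h := congrFun (congrFun hDK i) j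
    rw [Matrix.diagonal_mul, Matrix.mul_diagonal] at h
    have h' : (lam i - lam j) * K i j = 0 := by linear_combination h
    exact (mul_eq_zero.1 h').resolve_left (sub_ne_zero.2 fun e => hij (hlam e))
  have hK0 : K = 0 := by
    ext i j
    by_cases hij : i = j
    · subst hij
      obtain ⟨m, hm⟩ := hX i
      have h := congrFun (congrFun hKX i) m
      rw [Matrix.mul_apply, Finset.sum_eq_single i
        (fun b _ hb => by rw [hoff i b hb.symm, zero_mul]) (by simp)] at h
      exact (mul_eq_zero.1 h).resolve_right hm
    · exact hoff i j hij
  rw [hH, hK0, mul_zero, zero_mul]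
end

section
/- Let S be an N×N matrix over ℂ with diagonalization S = V · diag(λ) · V⁻¹, where V is invertible and the entries of λ ∈ ℂ^N are pairwise distinct. Let X be an N×M complex matrix such that every row of V⁻¹·X has at least one nonzero entry, and let γ > 0. Then for every N×N complex matrix H with H ≠ 0, one has ‖H·X‖_F² + γ·‖S·H − H·S‖_F² > 0; that is, the nonnegative quadratic form H ↦ ‖H·X‖_F² + γ·‖S·H − H·S‖_F² on N×N matrices is positive definite. -/
/-- Squared Frobenius norm of a complex matrix: `Σ_{i,j} |M_{ij}|²`. -/
noncomputable def frobSq {n m : Type*} [Fintype n] [Fintype m] (M : Matrix n m ℂ) : ℝ :=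
  ∑ i, ∑ j, ‖M i j‖ ^ 2

theorem frobSq_nonneg_aux {n m : Type*} [Fintype n] [Fintype m] (A : Matrix n m ℂ) :
    0 ≤ frobSq A :=
  Finset.sum_nonneg fun _ _ => Finset.sum_nonneg fun _ _ => sq_nonneg _

theorem frobSq_eq_zero_aux {n m : Type*} [Fintype n] [Fintype m] (A : Matrix n m ℂ)
    (h : frobSq A = 0) : A = 0 := by
  unfold frobSq at h
  rw [Finset.sum_eq_zero_iff_of_nonneg
    (fun _ _ => Finset.sum_nonneg fun _ _ => sq_nonneg _)] at h
  ext i j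
  have h1 := h i (Finset.mem_univ _)
  rw [Finset.sum_eq_zero_iff_of_nonneg (fun _ _ => sq_nonneg _)] at h1
  simpa using h1 j (Finset.mem_univ _)

/-- Under the hypotheses of Proposition 1, the quadratic form
`H ↦ ‖H X‖_F² + γ ‖S H − H S‖_F²` is positive definite. -/
theorem statement8 {N M : ℕ} (S V : Matrix (Fin N) (Fin N) ℂ) (hV : IsUnit V)
    (lam : Fin N → ℂ) (hlam : Function.Injective lam)
    (hS : S = V * Matrix.diagonal lam * V⁻¹)
    (X : Matrix (Fin N) (Fin M) ℂ) (hX : ∀ i : Fin N, ∃ m : Fin M, (V⁻¹ * X) i m ≠ 0)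
    (γ : ℝ) (hγ : 0 < γ) (H : Matrix (Fin N) (Fin N) ℂ) (hH : H ≠ 0) :
    0 < frobSq (H * X) + γ * frobSq (S * H - H * S) := by
  have hd : IsUnit V.det := (Matrix.isUnit_iff_isUnit_det V).1 hV
  have hVl : V⁻¹ * V = 1 := Matrix.nonsing_inv_mul V hd
  have hVr : V * V⁻¹ = 1 := Matrix.mul_nonsing_inv V hd
  have n1 := frobSq_nonneg_aux (H * X)
  have n2 := frobSq_nonneg_aux (S * H - H * S)
  have n3 := mul_nonneg hγ.le n2
  by_contra hcon
  have e1 : H * X = 0 := frobSq_eq_zero_aux _ (by linarith)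
  have e2 : S * H - H * S = 0 := by
    apply frobSq_eq_zero_aux
    have h0 : γ * frobSq (S * H - H * S) = 0 := by linarith
    exact (mul_eq_zero.1 h0).resolve_left hγ.ne'
  have e3 : S * H = H * S := sub_eq_zero.1 e2
  apply hH
  obtain ⟨G, hG⟩ : ∃ G, G = V⁻¹ * H * V := ⟨_, rfl⟩
  have hHG : H = V * G * V⁻¹ := by
    calc H = (V * V⁻¹) * H * (V * V⁻¹) := by rw [hVr]; simp
      _ = V * G * V⁻¹ := by rw [hG]; simp only [Matrix.mul_assoc]
  have hc : Matrix.diagonal lam * G = G * Matrix.diagonal lam := by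
    calc Matrix.diagonal lam * G
        = (V⁻¹ * V) * Matrix.diagonal lam * (V⁻¹ * H * V) := by rw [hVl, hG]; simp
      _ = V⁻¹ * (S * H) * V := by rw [hS]; simp only [Matrix.mul_assoc]
      _ = V⁻¹ * (H * S) * V := by rw [e3]
      _ = (V⁻¹ * H * V) * Matrix.diagonal lam * (V⁻¹ * V) := by
          rw [hS]; simp only [Matrix.mul_assoc]
      _ = G * Matrix.diagonal lam := by rw [hVl, hG]; simp
  have hoff : ∀ i j, i ≠ j → G i j = 0 := by
    intro i j hij
    have h := congrFun (congrFun hc i) j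
    rw [Matrix.diagonal_mul, Matrix.mul_diagonal] at h
    have h2 : (lam i - lam j) * G i j = 0 := by linear_combination h
    exact (mul_eq_zero.1 h2).resolve_left (sub_ne_zero.2 fun e => hij (hlam e))
  have hGY : G * (V⁻¹ * X) = 0 := by
    calc G * (V⁻¹ * X) = V⁻¹ * (H * ((V * V⁻¹) * X)) := by
          rw [hG]; simp only [Matrix.mul_assoc]
      _ = 0 := by rw [hVr, Matrix.one_mul, e1, Matrix.mul_zero]
  have hG0 : G = 0 := by
    ext i j
    by_cases hij : i = j
    · subst hij
      obtain ⟨m, hm⟩ := hX i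
      have h := congrFun (congrFun hGY i) m
      rw [Matrix.mul_apply, Finset.sum_eq_single i
        (fun k _ hk => by rw [hoff i k hk.symm, zero_mul]) (by simp)] at h
      exact (mul_eq_zero.1 h).resolve_right hm
    · exact hoff i j hij
  rw [hHG, hG0]; simp
end

section
/- (Proposition 1.) Let S be an N×N matrix over ℂ with diagonalization S = V · diag(λ) · V⁻¹, where V is invertible and the entries of λ ∈ ℂ^N are pairwise distinct. Let X and Y be N×M complex matrices such that every row of V⁻¹·X has at least one nonzero entry, and let γ > 0. Then the function f₁(H) = ‖Y − H·X‖_F² + γ·‖S·H − H·S‖_F², defined on N×N complex matrices, has a unique global minimizer; that is, there exists a unique H* such that f₁(H*) ≤ f₁(H) for all N×N matrices H. -/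
theorem aux_lsq {E F : Type*} [AddCommGroup E] [Module ℂ E] [FiniteDimensional ℂ E]
    [NormedAddCommGroup F] [InnerProductSpace ℂ F] (L : E →ₗ[ℂ] F)
    (hL : Function.Injective L) (b : F) :
    ∃! x : E, ∀ y : E, ‖b - L x‖ ^ 2 ≤ ‖b - L y‖ ^ 2 := by
  obtain ⟨x, hx⟩ : (L.range.starProjection b) ∈ L.range :=
    Submodule.starProjection_apply_mem _ _
  have key : ∀ y, ‖b - L y‖ ^ 2 = ‖b - L x‖ ^ 2 + ‖L x - L y‖ ^ 2 := by
    intro y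
    have h0 : inner ℂ (b - L x) (L x - L y) = 0 := by
      rw [hx]
      apply Submodule.starProjection_inner_eq_zero
      rw [← hx, ← map_sub]
      exact ⟨_, rfl⟩
    have h1 := norm_add_sq_eq_norm_sq_add_norm_sq_of_inner_eq_zero (b - L x) (L x - L y) h0
    rw [sub_add_sub_cancel] at h1
    simpa [sq] using h1
  refine ⟨x, fun y => ?_, fun y hy => ?_⟩
  · rw [key y]
    nlinarith [sq_nonneg ‖L x - L y‖]
  · have h1 := hy x
    rw [key y] at h1
    have h2 : ‖L x - L y‖ ^ 2 = 0 := le_antisymm (by linarith) (sq_nonneg _)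
    have h3 : L x - L y = 0 := by simpa using h2
    exact hL (sub_eq_zero.mp h3).symm

theorem aux_inj {N M : ℕ} (S V : Matrix (Fin N) (Fin N) ℂ) (hV : IsUnit V)
    (lam : Fin N → ℂ) (hlam : Function.Injective lam)
    (hS : S = V * Matrix.diagonal lam * V⁻¹)
    (X : Matrix (Fin N) (Fin M) ℂ) (hX : ∀ i : Fin N, ∃ m : Fin M, (V⁻¹ * X) i m ≠ 0)
    (H : Matrix (Fin N) (Fin N) ℂ) (h1 : H * X = 0) (h2 : S * H - H * S = 0) : H = 0 := by
  have hd : IsUnit V.det := (Matrix.isUnit_iff_isUnit_det V).mp hV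
  have e1 : V⁻¹ * V = 1 := Matrix.nonsing_inv_mul V hd
  have e2 : V * V⁻¹ = 1 := Matrix.mul_nonsing_inv V hd
  obtain ⟨G, hG⟩ : ∃ G, G = V⁻¹ * H * V := ⟨_, rfl⟩
  have hH : H = V * G * V⁻¹ := by
    rw [hG]
    calc H = (V * V⁻¹) * H * (V * V⁻¹) := by simp [e2]
      _ = _ := by simp only [Matrix.mul_assoc]
  have hD : Matrix.diagonal lam * G = G * Matrix.diagonal lam := by
    have h3 : V⁻¹ * (S * H) * V = V⁻¹ * (H * S) * V := by rw [sub_eq_zero.mp h2]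
    calc Matrix.diagonal lam * G
        = (V⁻¹ * V) * Matrix.diagonal lam * (V⁻¹ * H * V) := by rw [e1, hG, Matrix.one_mul]
      _ = V⁻¹ * (S * H) * V := by rw [hS]; simp only [Matrix.mul_assoc]
      _ = V⁻¹ * (H * S) * V := h3
      _ = (V⁻¹ * H * V) * Matrix.diagonal lam * (V⁻¹ * V) := by
          rw [hS]; simp only [Matrix.mul_assoc]
      _ = _ := by rw [e1, hG, Matrix.mul_one]
  have hoff : ∀ i j, i ≠ j → G i j = 0 := by
    intro i j hij
    have h4 := congrFun (congrFun hD i) j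
    rw [Matrix.diagonal_mul, Matrix.mul_diagonal] at h4
    have h5 : (lam i - lam j) * G i j = 0 := by linear_combination h4
    exact (mul_eq_zero.mp h5).resolve_left (sub_ne_zero.mpr (fun h => hij (hlam h)))
  have hGX : G * (V⁻¹ * X) = 0 := by
    calc G * (V⁻¹ * X) = V⁻¹ * H * (V * V⁻¹) * X := by rw [hG]; simp only [Matrix.mul_assoc]
      _ = V⁻¹ * (H * X) := by rw [e2, Matrix.mul_one, Matrix.mul_assoc]
      _ = 0 := by rw [h1, Matrix.mul_zero]
  have hG0 : G = 0 := by
    ext i j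
    by_cases hij : i = j
    · subst hij
      obtain ⟨m, hm⟩ := hX i
      have h6 := congrFun (congrFun hGX i) m
      rw [Matrix.mul_apply, Finset.sum_eq_single i] at h6
      · exact (mul_eq_zero.mp h6).resolve_right hm
      · intro k _ hk
        rw [hoff i k hk.symm, zero_mul]
      · simp
    · exact hoff i j hij
  rw [hH, hG0]; simp

noncomputable def auxL {N M : ℕ} (S : Matrix (Fin N) (Fin N) ℂ) (X : Matrix (Fin N) (Fin M) ℂ)
    (γ : ℝ) : Matrix (Fin N) (Fin N) ℂ →ₗ[ℂ]
      EuclideanSpace ℂ ((Fin N × Fin M) ⊕ (Fin N × Fin N)) where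
  toFun H := WithLp.toLp 2 (Sum.elim (fun p => (H * X) p.1 p.2)
    (fun p => (Real.sqrt γ : ℂ) * (S * H - H * S) p.1 p.2))
  map_add' A B := by
    ext p
    rcases p with p | p
    · simp [Matrix.add_mul]
    · simp [Matrix.add_mul, Matrix.mul_add]; ring
  map_smul' c A := by
    ext p
    rcases p with p | p
    · simp
    · simp; ring

theorem aux_norm {N M : ℕ} (S : Matrix (Fin N) (Fin N) ℂ) (X Y : Matrix (Fin N) (Fin M) ℂ)
    (γ : ℝ) (hγ : 0 < γ) (H : Matrix (Fin N) (Fin N) ℂ) :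
    ‖(WithLp.toLp 2 (Sum.elim (fun p => Y p.1 p.2) (fun _ => 0)) :
      EuclideanSpace ℂ ((Fin N × Fin M) ⊕ (Fin N × Fin N))) - auxL S X γ H‖ ^ 2 =
    frobSq (Y - H * X) + γ * frobSq (S * H - H * S) := by
  rw [EuclideanSpace.norm_sq_eq, Fintype.sum_sum_type, Fintype.sum_prod_type,
    Fintype.sum_prod_type]
  simp only [frobSq, Finset.mul_sum]
  congr 1
  refine Finset.sum_congr rfl fun i _ => Finset.sum_congr rfl fun j _ => ?_
  simp only [auxL, LinearMap.coe_mk, AddHom.coe_mk, PiLp.sub_apply, Sum.elim_inr, zero_sub,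
    norm_neg, norm_mul, mul_pow]
  rw [Complex.norm_real, Real.norm_eq_abs, sq_abs, Real.sq_sqrt hγ.le]

/-- Proposition 1: the objective `f₁(H) = ‖Y − H X‖_F² + γ ‖S H − H S‖_F²` of the
graph-filter identification step has a unique global minimizer. -/
theorem statement9 {N M : ℕ} (S V : Matrix (Fin N) (Fin N) ℂ) (hV : IsUnit V)
    (lam : Fin N → ℂ) (hlam : Function.Injective lam)
    (hS : S = V * Matrix.diagonal lam * V⁻¹)
    (X Y : Matrix (Fin N) (Fin M) ℂ) (hX : ∀ i : Fin N, ∃ m : Fin M, (V⁻¹ * X) i m ≠ 0)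
    (γ : ℝ) (hγ : 0 < γ) :
    ∃! Hstar : Matrix (Fin N) (Fin N) ℂ,
      ∀ H : Matrix (Fin N) (Fin N) ℂ,
        frobSq (Y - Hstar * X) + γ * frobSq (S * Hstar - Hstar * S) ≤
          frobSq (Y - H * X) + γ * frobSq (S * H - H * S) := by
  have hinj : Function.Injective (auxL S X γ) := by
    rw [injective_iff_map_eq_zero]
    intro H hH
    have hc : ∀ p, auxL S X γ H p = 0 := fun p => by rw [hH]; rfl
    refine aux_inj S V hV lam hlam hS X hX H ?_ ?_
    · ext i j
      exact hc (Sum.inl (i, j))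
    · ext i j
      have h : (Real.sqrt γ : ℂ) * (S * H - H * S) i j = 0 := hc (Sum.inr (i, j))
      refine (mul_eq_zero.mp h).resolve_left ?_
      exact_mod_cast (Real.sqrt_pos.mpr hγ).ne'
  have := aux_lsq (auxL S X γ) hinj
    (WithLp.toLp 2 (Sum.elim (fun p => Y p.1 p.2) (fun _ => 0)))
  simpa only [aux_norm S X Y γ hγ] using this
end
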